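/- arXiv:2010.06586 — 3 statements merged into one kernel-verified Lean document; each statement's English description precedes it below -/
import Mathlib

section
/- The Hankel determinant of the shifted Catalan numbers det_{0≤i,j≤n-1}(C_{i+j+5}) equals (8/(5!·7!))·(n+1)(n+2)^2(n+3)^2(n+4)(2n+3)(2n+5)^2(2n+7) for every positive integer n. -/
open Polynomial in
/-- The monic Jacobi polynomials on `[0, 4]` for the weight `x ^ (9 / 2) * (4 - x) ^ (1 / 2)`,
whose moments are proportional to the Catalan numbers `catalan (m + 5)`. -/
noncomputable def catalanJacobi : ℕ → ℚ[X]
  | 0 => 1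
  | 1 => X - C (22 / 7)
  | n + 2 =>
      X * catalanJacobi (n + 1)
        - C (2 + 40 / ((2 * n + 7) * (2 * n + 9)) : ℚ) * catalanJacobi (n + 1)
        - C ((n + 1) * (2 * n + 3) * (2 * n + 11) * (n + 6) /
            ((2 * n + 7) ^ 2 * (n + 4) * (n + 3)) : ℚ) * catalanJacobi n

/-- The closed form of the `m`-th moment of `catalanJacobi n`. -/
def catalanJacobiMoment : ℕ → ℕ → ℚ
  | 0, m => catalan (m + 5)
  | n + 1, m =>
      catalanJacobiMoment n m * ((m - n) / (m + 7 + n)) *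
        ((2 * n + 3) * (n + 6) / ((n + 3) * (2 * n + 7)))

theorem catalan_succ_eq_mul_div (n : ℕ) :
    (catalan (n + 1) : ℚ) = catalan n * (2 * (2 * n + 1) / (n + 2)) := by
  have h₀ : ((n : ℚ) + 1) * catalan n = n.centralBinom := by
    exact_mod_cast succ_mul_catalan_eq_centralBinom n
  have h₁ : ((n : ℚ) + 1 + 1) * catalan (n + 1) = (n + 1).centralBinom := by
    exact_mod_cast succ_mul_catalan_eq_centralBinom (n + 1)
  have h₂ : ((n : ℚ) + 1) * (n + 1).centralBinom = 2 * (2 * n + 1) * n.centralBinom := by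
    exact_mod_cast Nat.succ_mul_centralBinom_succ n
  rw [← h₀, ← h₁] at h₂
  have hn : (n : ℚ) + 1 ≠ 0 := by positivity
  field_simp
  apply mul_left_cancel₀ hn
  linear_combination h₂

theorem catalanJacobiMoment_succ_succ (n m : ℕ) :
    catalanJacobiMoment (n + 1) (m + 1) =
      catalanJacobiMoment n m *
        ((2 * n + 3) * (n + 6) / ((n + 3) * (2 * n + 7))) *
        (2 * (2 * m + 11) * (m + 1) / ((m + 7 + n) * (m + 8 + n))) := by
  induction n with
  | zero =>
    simp only [catalanJacobiMoment]
    rw [show m + 1 + 5 = m + 5 + 1 by ring, catalan_succ_eq_mul_div (m + 5)]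
    push_cast
    field_simp
    ring
  | succ n ih =>
    rw [catalanJacobiMoment, ih, catalanJacobiMoment]
    push_cast
    field_simp
    ring

theorem catalanJacobiMoment_add_two (n m : ℕ) :
    catalanJacobiMoment (n + 2) m =
      catalanJacobiMoment (n + 1) (m + 1)
        - (2 + 40 / ((2 * n + 7) * (2 * n + 9))) * catalanJacobiMoment (n + 1) m
        - ((n + 1) * (2 * n + 3) * (2 * n + 11) * (n + 6) /
            ((2 * n + 7) ^ 2 * (n + 4) * (n + 3))) * catalanJacobiMoment n m := by
  rw [catalanJacobiMoment_succ_succ, catalanJacobiMoment, catalanJacobiMoment]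
  push_cast
  field_simp
  ring

theorem catalanJacobiMoment_one (m : ℕ) :
    catalanJacobiMoment 1 m =
      catalanJacobiMoment 0 (m + 1) - 22 / 7 * catalanJacobiMoment 0 m := by
  simp only [catalanJacobiMoment]
  rw [show m + 1 + 5 = m + 5 + 1 by ring, catalan_succ_eq_mul_div (m + 5)]
  push_cast
  field_simp
  ring

theorem catalanJacobiMoment_eq_zero {n m : ℕ} (h : m < n) : catalanJacobiMoment n m = 0 := by
  induction n with
  | zero => omega
  | succ n ih =>
    rw [catalanJacobiMoment]
    rcases Nat.lt_succ_iff_lt_or_eq.mp h with h | rfl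
    · simp [ih h]
    · simp

theorem catalanJacobi_coeff_of_lt (n : ℕ) {k : ℕ} (h : n < k) :
    (catalanJacobi n).coeff k = 0 := by
  induction n using Nat.twoStepInduction generalizing k with
  | zero => simp [catalanJacobi, Polynomial.coeff_one, h.ne']
  | one =>
    rw [catalanJacobi, Polynomial.coeff_sub, Polynomial.coeff_X_of_ne_one h.ne',
      Polynomial.coeff_C_of_ne_zero (by omega), sub_zero]
  | more n ih₀ ih₁ =>
    obtain ⟨k, rfl⟩ := Nat.exists_eq_succ_of_ne_zero (show k ≠ 0 by omega)
    simp only [catalanJacobi, Nat.succ_eq_add_one, Polynomial.coeff_sub, Polynomial.coeff_X_mul,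
      Polynomial.coeff_C_mul]
    rw [ih₁ (by omega), ih₁ (by omega), ih₀ (by omega)]
    ring

theorem catalanJacobi_coeff_self (n : ℕ) : (catalanJacobi n).coeff n = 1 := by
  induction n using Nat.twoStepInduction with
  | zero => simp [catalanJacobi]
  | one => simp [catalanJacobi]
  | more n _ ih =>
    simp only [catalanJacobi, Polynomial.coeff_sub, Polynomial.coeff_C_mul]
    rw [Polynomial.coeff_X_mul, ih, catalanJacobi_coeff_of_lt (n + 1) (by omega),
      catalanJacobi_coeff_of_lt n (by omega)]
    ring

theorem sum_catalanJacobi_coeff_mul_catalan {n N : ℕ} (h : n < N) (m : ℕ) :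
    ∑ k ∈ Finset.range N, (catalanJacobi n).coeff k * (catalan (k + m + 5) : ℚ) =
      catalanJacobiMoment n m := by
  induction n using Nat.twoStepInduction generalizing N m with
  | zero =>
    rw [Finset.sum_eq_single_of_mem 0 (Finset.mem_range.mpr h)]
    · simp [catalanJacobi, catalanJacobiMoment]
    · intro k _ hk
      simp [catalanJacobi, Polynomial.coeff_one, hk]
  | one =>
    obtain ⟨N, rfl⟩ := Nat.exists_eq_add_of_le' (show 2 ≤ N by omega)
    rw [catalanJacobiMoment_one, Finset.sum_range_succ', Finset.sum_range_succ',
      Finset.sum_eq_zero]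
    · simp [catalanJacobi, catalanJacobiMoment, Polynomial.coeff_C, add_comm 1 m]
      ring
    · intro k _
      rw [catalanJacobi_coeff_of_lt 1 (by omega), zero_mul]
  | more n ih₀ ih₁ =>
    obtain ⟨N, rfl⟩ := Nat.exists_eq_add_of_le' (show 1 ≤ N by omega)
    have hX : ∑ k ∈ Finset.range (N + 1), (Polynomial.X * catalanJacobi (n + 1)).coeff k *
        (catalan (k + m + 5) : ℚ) = catalanJacobiMoment (n + 1) (m + 1) := by
      rw [Finset.sum_range_succ', Polynomial.coeff_X_mul_zero, zero_mul, add_zero,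
        ← ih₁ (N := N) (by omega)]
      refine Finset.sum_congr rfl fun k _ => ?_
      rw [Polynomial.coeff_X_mul, add_right_comm k 1 m, add_assoc k m 1]
    rw [catalanJacobiMoment_add_two, ← hX, ← ih₁ (N := N + 1) (by omega),
      ← ih₀ (N := N + 1) (by omega), Finset.mul_sum, Finset.mul_sum, ← Finset.sum_sub_distrib,
      ← Finset.sum_sub_distrib]
    refine Finset.sum_congr rfl fun k _ => ?_
    simp only [catalanJacobi, Polynomial.coeff_sub, Polynomial.coeff_C_mul]
    ring

theorem det_hankel_catalan_eq_prod (n : ℕ) :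
    Matrix.det (Matrix.of (fun i j : Fin n => (catalan ((i : ℕ) + j + 5) : ℚ))) =
      ∏ k ∈ Finset.range n, catalanJacobiMoment k k := by
  let P : Matrix (Fin n) (Fin n) ℚ := Matrix.of fun i k => (catalanJacobi i).coeff k
  have hP : P.det = 1 := by
    rw [Matrix.det_of_isLowerTriangular P fun i j hij => catalanJacobi_coeff_of_lt _ hij]
    exact Finset.prod_eq_one fun i _ => catalanJacobi_coeff_self i
  have hmul : P * Matrix.of (fun i j : Fin n => (catalan ((i : ℕ) + j + 5) : ℚ)) =
      Matrix.of fun i j : Fin n => catalanJacobiMoment i j := by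
    ext i j
    rw [Matrix.mul_apply, Matrix.of_apply, ← sum_catalanJacobi_coeff_mul_catalan i.isLt,
      Finset.sum_range]
    rfl
  have hU : (Matrix.of fun i j : Fin n => catalanJacobiMoment i j).IsUpperTriangular :=
    fun i j hij => catalanJacobiMoment_eq_zero hij
  rw [← one_mul (Matrix.det _), ← hP, ← Matrix.det_mul, hmul,
    Matrix.det_of_isUpperTriangular hU, Finset.prod_range]
  rfl

theorem catalanJacobiMoment_self (n : ℕ) :
    catalanJacobiMoment n n =
      (n + 4) * (n + 5) * (2 * n + 7) * (2 * n + 9) /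
        ((n + 1) * (n + 2) * (2 * n + 3) * (2 * n + 5)) := by
  induction n with
  | zero =>
    have h : catalan 5 = 42 := by rw [catalan_eq_centralBinom_div]; decide
    norm_num [catalanJacobiMoment, h]
  | succ n ih =>
    rw [catalanJacobiMoment_succ_succ, ih]
    push_cast
    field_simp
    ring

theorem hankel_catalan_shift5 (n : ℕ) (hn : 0 < n) :
    Matrix.det (Matrix.of (fun i j : Fin n => (catalan ((i : ℕ) + j + 5) : ℚ))) =
      (8 / (Nat.factorial 5 * Nat.factorial 7 : ℚ)) *
        ((n + 1) * (n + 2) ^ 2 * (n + 3) ^ 2 * (n + 4) *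
          (2 * n + 3) * (2 * n + 5) ^ 2 * (2 * n + 7)) := by
  rw [det_hankel_catalan_eq_prod]
  clear hn
  induction n with
  | zero => norm_num [Nat.factorial]
  | succ n ih =>
    rw [Finset.prod_range_succ, ih, catalanJacobiMoment_self]
    norm_num only [Nat.factorial]
    push_cast
    field_simp
    ring
end

section
/- The Hankel determinant of the shifted Catalan numbers det_{0≤i,j≤n-1}(C_{i+j+6}) equals (2^5/(5·7!·9!))·(n+1)(n+2)^2(n+3)^3(n+4)^2(n+5)(2n+3)(2n+5)^2(2n+7)^2(2n+9) for every positive integer n. -/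
/-- The product `∏_{i<n} (4i + 26)`, that is `4 ^ n` times the rising factorial `(13/2)_n`. -/
def numer (n : ℕ) : ℚ := ∏ i ∈ Finset.range n, (4 * (i : ℚ) + 26)

/-- The entries of the unitriangular factor in the LDL decomposition of the Hankel matrix
`C_{i+j+6}`: the expansion coefficients of `x ^ n` in the associated monic Jacobi polynomials. -/
def stieltjes (n k : ℕ) : ℚ :=
  n.choose k * numer n / numer k * (2 * k + 7).factorial / (n + k + 7).factorial

/-- The squared norms of the monic Jacobi polynomials with moments `C_{k+6}`. -/
def pivot (k : ℕ) : ℚ :=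
  (k + 4) * (k + 5) * (k + 6) * (2 * k + 9) * (2 * k + 11) /
    ((k + 1) * (k + 2) * (k + 3) * (2 * k + 3) * (2 * k + 5))

/-- The diagonal coefficient of the three-term recurrence. -/
def recDiag (k : ℕ) : ℚ := 2 + 15 / ((k + 3) * (k + 4))

/-- The off-diagonal coefficient of the three-term recurrence. -/
def recOff (k : ℕ) : ℚ :=
  (k + 1) * (2 * k + 3) * (2 * k + 13) * (k + 7) / ((k + 4) ^ 2 * (2 * k + 9) * (2 * k + 7))

theorem numer_succ (n : ℕ) : numer (n + 1) = numer n * (4 * n + 26) :=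
  Finset.prod_range_succ _ _

theorem numer_ne_zero (n : ℕ) : numer n ≠ 0 :=
  Finset.prod_ne_zero_iff.2 fun i _ => by positivity

theorem cast_choose_succ (n k : ℕ) :
    (n.choose (k + 1) : ℚ) = n.choose k * (n - k) / (k + 1) := by
  have h : (n.choose (k + 1) : ℚ) * (k + 1) = n.choose k * (n - k) := by
    rcases le_or_gt k n with hk | hk
    · rw [← Nat.cast_sub hk]
      exact_mod_cast Nat.choose_succ_right_eq n k
    · simp [Nat.choose_eq_zero_of_lt hk, Nat.choose_eq_zero_of_lt (Nat.lt_succ_of_lt hk)]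
  field_simp
  linarith

theorem pivot_succ (k : ℕ) : pivot (k + 1) = recOff k * pivot k := by
  unfold pivot recOff
  push_cast
  field_simp
  ring

theorem stieltjes_eq_zero {n k : ℕ} (h : n < k) : stieltjes n k = 0 := by
  simp [stieltjes, Nat.choose_eq_zero_of_lt h]

theorem stieltjes_self (n : ℕ) : stieltjes n n = 1 := by
  have := numer_ne_zero n
  have := Nat.factorial_ne_zero (2 * n + 7)
  simp only [stieltjes, Nat.choose_self, ← two_mul]
  field_simp
  simp

theorem stieltjes_succ_zero (n : ℕ) :
    stieltjes (n + 1) 0 = recDiag 0 * stieltjes n 0 + recOff 0 * stieltjes n 1 := by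
  have h0 := numer_ne_zero 0
  have hf : ((n + 7).factorial : ℚ) ≠ 0 := by positivity
  have e1 : n + 1 + 0 + 7 = n + 7 + 1 := by ring
  simp only [stieltjes, e1, add_zero, Nat.factorial_succ (n + 7), numer_succ n,
    numer_succ 0, recDiag, recOff, Nat.choose_zero_right, Nat.choose_one_right]
  have e3 : (2 * 1 + 7).factorial = 72 * (2 * 0 + 7).factorial := by decide
  have hg : ((2 * 0 + 7).factorial : ℚ) ≠ 0 := by positivity
  rw [e3]
  push_cast
  field_simp
  ring

theorem stieltjes_succ_succ (n k : ℕ) :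
    stieltjes (n + 1) (k + 1) = stieltjes n k + recDiag (k + 1) * stieltjes n (k + 1) +
      recOff (k + 1) * stieltjes n (k + 2) := by
  have h0 := numer_ne_zero k
  have hf : ((n + k + 7).factorial : ℚ) ≠ 0 := by positivity
  have hg : ((2 * k + 7).factorial : ℚ) ≠ 0 := by positivity
  have e1 : n + 1 + (k + 1) + 7 = n + k + 7 + 1 + 1 := by ring
  have e2 : n + (k + 1) + 7 = n + k + 7 + 1 := by ring
  have e3 : n + (k + 2) + 7 = n + k + 7 + 1 + 1 := by ring
  have e4 : 2 * (k + 1) + 7 = 2 * k + 7 + 1 + 1 := by ring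
  have e5 : 2 * (k + 2) + 7 = 2 * k + 7 + 1 + 1 + 1 + 1 := by ring
  have e6 : numer (k + 2) = numer k * (4 * k + 26) * (4 * k + 30) := by
    rw [show k + 2 = k + 1 + 1 from rfl, numer_succ, numer_succ]; push_cast; ring
  have e7 : (n.choose (k + 2) : ℚ) =
      n.choose k * (n - k) / (k + 1) * (n - k - 1) / (k + 2) := by
    rw [show k + 2 = k + 1 + 1 from rfl, cast_choose_succ, cast_choose_succ]; push_cast; ring
  simp only [stieltjes, e1, e2, e3, e4, e5, e6, e7, Nat.factorial_succ (_ + _),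
    numer_succ, recDiag, recOff, Nat.choose_succ_succ n k, Nat.cast_add, Nat.cast_mul,
    cast_choose_succ, Nat.cast_one, Nat.cast_ofNat]
  field_simp
  ring

theorem catalan_succ_mul (n : ℕ) :
    (n + 2 : ℚ) * catalan (n + 1) = (4 * n + 2) * catalan n := by
  have h1 := succ_mul_catalan_eq_centralBinom n
  have h2 := succ_mul_catalan_eq_centralBinom (n + 1)
  have h3 := Nat.succ_mul_centralBinom_succ n
  rw [← h1, ← h2] at h3
  have h4 : ((n : ℚ) + 1) * ((n + 1 + 1) * catalan (n + 1)) =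
      2 * (2 * n + 1) * ((n + 1) * catalan n) := by exact_mod_cast h3
  have h5 : (n : ℚ) + 1 ≠ 0 := by positivity
  apply mul_left_cancel₀ h5
  linarith

theorem catalan_six : catalan 6 = 132 := by
  rw [catalan_eq_centralBinom_div]
  decide

theorem stieltjes_zero_right (n : ℕ) : 132 * stieltjes n 0 = catalan (n + 6) := by
  induction n with
  | zero => simp [stieltjes_self, catalan_six]
  | succ n ih =>
    have h := catalan_succ_mul (n + 6)
    rw [← ih] at h
    have e : n + 1 + 6 = n + 6 + 1 := by ring
    have h8 : ((n + 6 : ℕ) : ℚ) + 2 ≠ 0 := by positivity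
    apply mul_left_cancel₀ h8
    rw [e, h]
    have h0 := numer_ne_zero 0
    have hf : ((n + 7).factorial : ℚ) ≠ 0 := by positivity
    simp only [stieltjes, show n + 1 + 0 + 7 = n + 7 + 1 by ring, add_zero,
      Nat.factorial_succ (n + 7), numer_succ n, Nat.choose_zero_right]
    push_cast
    field_simp
    ring

theorem sum_stieltjes_telescope (i j N : ℕ) :
    ∑ k ∈ Finset.range (N + 1), pivot k *
        (stieltjes (i + 1) k * stieltjes j k - stieltjes i k * stieltjes (j + 1) k) =
      pivot (N + 1) * (stieltjes i (N + 1) * stieltjes j N -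
        stieltjes i N * stieltjes j (N + 1)) := by
  induction N with
  | zero =>
    simp only [zero_add, Finset.sum_range_one, stieltjes_succ_zero]
    rw [show (1 : ℕ) = 0 + 1 from rfl, pivot_succ]
    ring
  | succ N ih =>
    rw [Finset.sum_range_succ, ih, stieltjes_succ_succ, stieltjes_succ_succ, pivot_succ (N + 1)]
    ring

theorem sum_stieltjes_mul (i j N : ℕ) (h : i + j ≤ N) :
    ∑ k ∈ Finset.range (N + 1), stieltjes i k * pivot k * stieltjes j k =
      catalan (i + j + 6) := by
  induction i generalizing j with
  | zero =>
    rw [Finset.sum_range_succ', Finset.sum_eq_zero]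
    · rw [stieltjes_self, zero_add, zero_add, ← stieltjes_zero_right]
      norm_num [pivot]
    · intro k _
      rw [stieltjes_eq_zero k.succ_pos]
      ring
  | succ i ih =>
    have ht := sum_stieltjes_telescope i j N
    rw [stieltjes_eq_zero (show i < N + 1 by omega),
      stieltjes_eq_zero (show j < N + 1 by omega)] at ht
    rw [show i + 1 + j + 6 = i + (j + 1) + 6 by ring, ← ih (j + 1) (by omega), ← sub_eq_zero,
      ← Finset.sum_sub_distrib]
    trans (0 : ℚ)
    · convert ht using 1
      · exact Finset.sum_congr rfl fun k _ => by ring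
      · ring
    · rfl

theorem sum_stieltjes_mul_of_lt {i n : ℕ} (j : ℕ) (h : i < n) :
    ∑ k ∈ Finset.range n, stieltjes i k * pivot k * stieltjes j k = catalan (i + j + 6) := by
  rw [← sum_stieltjes_mul i j (i + j + n) (by omega)]
  refine Finset.sum_subset (Finset.range_mono (by omega)) fun k _ hk => ?_
  rw [stieltjes_eq_zero (h.trans_le (by simpa using hk))]
  ring

theorem prod_pivot (n : ℕ) : ∏ k ∈ Finset.range n, pivot k =
    (2 ^ 5 / (5 * Nat.factorial 7 * Nat.factorial 9 : ℚ)) *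
      ((n + 1) * (n + 2) ^ 2 * (n + 3) ^ 3 * (n + 4) ^ 2 * (n + 5) *
        (2 * n + 3) * (2 * n + 5) ^ 2 * (2 * n + 7) ^ 2 * (2 * n + 9)) := by
  induction n with
  | zero => norm_num [Nat.factorial]
  | succ n ih =>
    rw [Finset.prod_range_succ, ih, pivot]
    push_cast
    field_simp
    ring

theorem hankel_catalan_shift6 (n : ℕ) (hn : 0 < n) :
    Matrix.det (Matrix.of (fun i j : Fin n => (catalan ((i : ℕ) + j + 6) : ℚ))) =
      (2 ^ 5 / (5 * Nat.factorial 7 * Nat.factorial 9 : ℚ)) *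
        ((n + 1) * (n + 2) ^ 2 * (n + 3) ^ 3 * (n + 4) ^ 2 * (n + 5) *
          (2 * n + 3) * (2 * n + 5) ^ 2 * (2 * n + 7) ^ 2 * (2 * n + 9)) := by
  let L : Matrix (Fin n) (Fin n) ℚ := Matrix.of fun i k => stieltjes i k
  have hL : L.det = 1 := by
    rw [Matrix.det_of_isLowerTriangular L fun i k h => stieltjes_eq_zero h]
    exact Finset.prod_eq_one fun i _ => stieltjes_self i
  have hH : Matrix.of (fun i j : Fin n => (catalan ((i : ℕ) + j + 6) : ℚ)) =
      L * Matrix.diagonal (fun k : Fin n => pivot k) * L.transpose := by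
    ext i j
    rw [Matrix.mul_apply]
    simp only [Matrix.mul_diagonal, Matrix.transpose_apply, L, Matrix.of_apply]
    rw [← sum_stieltjes_mul_of_lt j i.isLt, Finset.sum_range]
  rw [hH, Matrix.det_mul, Matrix.det_mul, Matrix.det_transpose, hL, Matrix.det_diagonal,
    ← prod_pivot, Finset.prod_range]
  ring
end

section
/- The Hankel determinant of the shifted Catalan numbers det_{0≤i,j≤n-1}(C_{i+j+7}) equals (3·2^10/(7!·9!·11!))·(n+1)(n+2)^2(n+3)^3(n+4)^3(n+5)^2(n+6)(2n+3)(2n+5)^2(2n+7)^3(2n+9)^2(2n+11) for every positive integer n. -/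
/-- The Catalan ratio `C (m + 1) / C m`, cleared of denominators. -/
theorem cast_catalan_succ_mul (m : ℕ) :
    (catalan (m + 1) : ℚ) * (m + 2) = 2 * (2 * m + 1) * catalan m := by
  have h₀ : ((m + 1) * catalan m : ℚ) = m.centralBinom := by
    exact_mod_cast succ_mul_catalan_eq_centralBinom m
  have h₁ : ((m + 2) * catalan (m + 1) : ℚ) = (m + 1).centralBinom := by
    exact_mod_cast succ_mul_catalan_eq_centralBinom (m + 1)
  have h₂ : ((m + 1) * (m + 1).centralBinom : ℚ) = 2 * (2 * m + 1) * m.centralBinom := by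
    exact_mod_cast Nat.succ_mul_centralBinom_succ m
  have hm : (m + 1 : ℚ) ≠ 0 := by positivity
  apply mul_left_cancel₀ hm
  linear_combination (m + 1 : ℚ) * h₁ + h₂ - 2 * (2 * m + 1 : ℚ) * h₀

theorem cast_catalan_succ_add (n r : ℕ) :
    (catalan (n + 1 + r) : ℚ) =
      2 * (2 * (n + r) + 1) * catalan (n + r) / (n + r + 2) := by
  have h := cast_catalan_succ_mul (n + r)
  rw [eq_div_iff (by positivity), show n + 1 + r = n + r + 1 by ring]
  push_cast at h
  exact h

/-- The unitriangular Stieltjes matrix of the normalized moments `C (n + r) / C r`. -/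
def stieltjesCatalan (r : ℕ) : ℕ → ℕ → ℚ
  | n, 0 => catalan (n + r) / catalan r
  | 0, _ + 1 => 0
  | n + 1, k + 1 => stieltjesCatalan r n k *
      ((n + 1) * (2 * n + 2 * r + 1) * (2 * k + r + 2) * (2 * k + r + 3) /
        ((k + 1) * (2 * k + 2 * r + 1) * (n + k + r + 2) * (n + k + r + 3)))

/-- The diagonal recurrence coefficients of the orthogonal polynomials with moments
`C (n + r)`. -/
def jacobiDiag (r k : ℕ) : ℚ :=
  2 * (k + 1) * (2 * k + 2 * r + 1) / (2 * k + r + 2) -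
    2 * k * (2 * k + 2 * r - 1) / (2 * k + r)

/-- The off-diagonal recurrence coefficients of the orthogonal polynomials with moments
`C (n + r)`. -/
def jacobiOffDiag (r k : ℕ) : ℚ :=
  4 * (k + 1) * (2 * k + 2 * r + 1) * (2 * k + 3) * (k + r + 1) /
    ((2 * k + r + 1) * (2 * k + r + 2) ^ 2 * (2 * k + r + 3))

/-- The squared norms of the monic orthogonal polynomials with moments `C (n + r)`. -/
def catalanNorm (r k : ℕ) : ℚ :=
  catalan r * ∏ j ∈ Finset.range k, jacobiOffDiag r j

theorem catalanNorm_succ (r k : ℕ) :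
    catalanNorm r (k + 1) = catalanNorm r k * jacobiOffDiag r k := by
  simp [catalanNorm, Finset.prod_range_succ, mul_assoc]

theorem cast_catalan_pos (r : ℕ) : 0 < (catalan r : ℚ) := by
  induction r with
  | zero => simp
  | succ r ih =>
    have h := cast_catalan_succ_mul r
    have : 0 < (catalan (r + 1) : ℚ) * (r + 2) := by rw [h]; positivity
    exact pos_of_mul_pos_left this (by positivity)

theorem stieltjesCatalan_succ_right (r n k : ℕ) :
    stieltjesCatalan r n (k + 1) = stieltjesCatalan r n k *
      ((n - k) * (2 * k + r + 2) * (2 * k + r + 3) /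
        (2 * (k + 1) * (2 * k + 2 * r + 1) * (n + k + r + 2))) := by
  induction k generalizing n with
  | zero =>
    cases n with
    | zero => simp [stieltjesCatalan]
    | succ n =>
      have hr := (cast_catalan_pos r).ne'
      simp only [stieltjesCatalan, cast_catalan_succ_add]
      push_cast
      field_simp
      ring
  | succ k ih =>
    cases n with
    | zero => simp [stieltjesCatalan]
    | succ n =>
      simp only [stieltjesCatalan]
      rw [ih n]
      push_cast
      field_simp
      ring

theorem stieltjesCatalan_self (r n : ℕ) : stieltjesCatalan r n n = 1 := by
  induction n with
  | zero => simp [stieltjesCatalan, (cast_catalan_pos r).ne']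
  | succ n ih =>
    simp only [stieltjesCatalan, ih]
    field_simp
    ring

theorem stieltjesCatalan_of_lt (r : ℕ) {n k : ℕ} (h : n < k) : stieltjesCatalan r n k = 0 := by
  induction n generalizing k with
  | zero =>
    obtain ⟨k, rfl⟩ := Nat.exists_eq_succ_of_ne_zero h.ne'
    rfl
  | succ n ih =>
    obtain ⟨k, rfl⟩ := Nat.exists_eq_succ_of_ne_zero (Nat.ne_zero_of_lt h)
    simp [stieltjesCatalan, ih (Nat.lt_of_succ_lt_succ h)]

theorem stieltjesCatalan_succ_zero (r n : ℕ) :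
    stieltjesCatalan r (n + 1) 0 =
      jacobiDiag r 0 * stieltjesCatalan r n 0 + jacobiOffDiag r 0 * stieltjesCatalan r n 1 := by
  have hr := (cast_catalan_pos r).ne'
  rw [stieltjesCatalan_succ_right]
  simp only [stieltjesCatalan, cast_catalan_succ_add, jacobiDiag, jacobiOffDiag]
  push_cast
  simp only [mul_zero, zero_mul, zero_div, zero_add, sub_zero]
  field_simp
  ring

theorem stieltjesCatalan_succ_succ (r n k : ℕ) :
    stieltjesCatalan r (n + 1) (k + 1) =
      stieltjesCatalan r n k + jacobiDiag r (k + 1) * stieltjesCatalan r n (k + 1) +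
        jacobiOffDiag r (k + 1) * stieltjesCatalan r n (k + 2) := by
  rw [stieltjesCatalan_succ_right r n (k + 1), stieltjesCatalan_succ_right r n k]
  simp only [stieltjesCatalan, jacobiDiag, jacobiOffDiag]
  push_cast
  field_simp
  ring

/-- The operator given by the three-term recurrence is symmetric for the weights
`catalanNorm r`, up to a boundary term. -/
theorem sum_stieltjesCatalan_succ_left_sub (r m n N : ℕ) :
    ∑ k ∈ Finset.range (N + 1), (stieltjesCatalan r (m + 1) k * stieltjesCatalan r n k -
      stieltjesCatalan r m k * stieltjesCatalan r (n + 1) k) * catalanNorm r k =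
    (stieltjesCatalan r m (N + 1) * stieltjesCatalan r n N -
      stieltjesCatalan r m N * stieltjesCatalan r n (N + 1)) * catalanNorm r (N + 1) := by
  induction N with
  | zero =>
    simp only [zero_add, Finset.sum_range_one, stieltjesCatalan_succ_zero, catalanNorm_succ r 0]
    ring
  | succ N ih =>
    rw [Finset.sum_range_succ, ih, stieltjesCatalan_succ_succ, stieltjesCatalan_succ_succ,
      catalanNorm_succ r (N + 1)]
    ring

theorem sum_stieltjesCatalan_mul (r m n N : ℕ) (h : m + n ≤ N) :
    ∑ k ∈ Finset.range (N + 1),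
      stieltjesCatalan r m k * stieltjesCatalan r n k * catalanNorm r k =
    catalan (m + n + r) := by
  induction m generalizing n with
  | zero =>
    rw [Finset.sum_eq_single_of_mem 0 (by simp)
      fun k _ hk => by simp [stieltjesCatalan_of_lt r (Nat.pos_of_ne_zero hk)]]
    have hr := (cast_catalan_pos r).ne'
    simp [stieltjesCatalan, catalanNorm]
    field_simp
  | succ m ih =>
    have hs := sum_stieltjesCatalan_succ_left_sub r m n N
    rw [stieltjesCatalan_of_lt r (show m < N + 1 by omega),
      stieltjesCatalan_of_lt r (show n < N + 1 by omega)] at hs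
    simp only [sub_mul, Finset.sum_sub_distrib] at hs
    rw [show m + 1 + n + r = m + (n + 1) + r by ring, ← ih (n + 1) (by omega)]
    linarith

/-- The Hankel determinants of the shifted Catalan numbers as products of norms. -/
theorem det_hankel_catalan (r n : ℕ) :
    Matrix.det (Matrix.of (fun i j : Fin n => (catalan ((i : ℕ) + j + r) : ℚ))) =
      ∏ k ∈ Finset.range n, catalanNorm r k := by
  set L : Matrix (Fin n) (Fin n) ℚ := Matrix.of fun i k => stieltjesCatalan r i k with hL
  have hdet : L.det = 1 := by
    rw [Matrix.det_of_isLowerTriangular L fun i j hij => stieltjesCatalan_of_lt r hij]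
    simp [hL, stieltjesCatalan_self]
  have hfac : Matrix.of (fun i j : Fin n => (catalan ((i : ℕ) + j + r) : ℚ)) =
      L * Matrix.diagonal (fun k : Fin n => catalanNorm r k) * L.transpose := by
    ext i j
    rw [Matrix.mul_apply]
    simp only [Matrix.mul_diagonal, Matrix.transpose_apply, hL, Matrix.of_apply]
    rw [Fin.sum_univ_eq_sum_range
      (fun k => stieltjesCatalan r i k * catalanNorm r k * stieltjesCatalan r j k),
      ← sum_stieltjesCatalan_mul r i j (n + n) (by omega)]
    symm
    refine Finset.sum_subset_zero_on_sdiff (Finset.range_mono (by omega)) (fun k hk => ?_)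
      fun k _ => mul_right_comm _ _ _
    have hk' : n ≤ k := by simpa using (Finset.mem_sdiff.1 hk).2
    simp [stieltjesCatalan_of_lt r (i.2.trans_le hk')]
  rw [hfac, Matrix.det_mul, Matrix.det_mul, Matrix.det_transpose, hdet, Matrix.det_diagonal,
    Fin.prod_univ_eq_prod_range (catalanNorm r)]
  ring

theorem catalan_seven : catalan 7 = 429 := by
  rw [catalan_eq_centralBinom_div, Nat.centralBinom_eq_two_mul_choose]
  decide

theorem catalanNorm_seven (k : ℕ) :
    catalanNorm 7 k =
      (k + 5) * (k + 6) * (k + 7) * (2 * k + 9) * (2 * k + 11) * (2 * k + 13) /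
        ((k + 1) * (k + 2) * (k + 3) * (2 * k + 3) * (2 * k + 5) * (2 * k + 7)) := by
  induction k with
  | zero => norm_num [catalanNorm, catalan_seven]
  | succ k ih =>
    rw [catalanNorm_succ, ih, jacobiOffDiag]
    push_cast
    field_simp
    ring

theorem hankel_catalan_shift7 (n : ℕ) (hn : 0 < n) :
    Matrix.det (Matrix.of (fun i j : Fin n => (catalan ((i : ℕ) + j + 7) : ℚ))) =
      (3 * 2 ^ 10 / (Nat.factorial 7 * Nat.factorial 9 * Nat.factorial 11 : ℚ)) *
        ((n + 1) * (n + 2) ^ 2 * (n + 3) ^ 3 * (n + 4) ^ 3 * (n + 5) ^ 2 * (n + 6) *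
          (2 * n + 3) * (2 * n + 5) ^ 2 * (2 * n + 7) ^ 3 * (2 * n + 9) ^ 2 * (2 * n + 11)) := by
  clear hn
  rw [det_hankel_catalan]
  induction n with
  | zero => norm_num [Nat.factorial]
  | succ n ih =>
    rw [Finset.prod_range_succ, ih, catalanNorm_seven]
    push_cast
    field_simp
    ring
end
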